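/- Let λ > 1 and C₂ > 0. There exists M₀ > 0 depending only on λ and C₂ such that: for every convex body K ⊂ ℝ³ containing the origin in its closure that solves the logarithmic Minkowski problem with density f with 1/λ < f < λ, if E is a John ellipsoid of K (E ⊂ K ⊂ 3^{3/2}E, centered at the center of mass) with principal radii r₁ ≤ r₂ ≤ r₃ satisfying 1/C₂ < r₃/r₂ < C₂, then r₂/r₁ ≤ M₀. -/

import Mathlib

open MeasureTheory Metric Set Filter
open scoped RealInnerProductSpace ENNReal NNReal Real

noncomputable section

abbrev E3 := EuclideanSpace ℝ (Fin 3)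

def unitSphere : Set E3 := Metric.sphere 0 1

def IsConvexBody (K : Set E3) : Prop :=
  Convex ℝ K ∧ IsCompact K ∧ (interior K).Nonempty

def suppFn (K : Set E3) (x : E3) : ℝ := sSup ((fun y => ⟪x, y⟫) '' K)

def outerNormalAt (K : Set E3) (x ν : E3) : Prop :=
  ‖ν‖ = 1 ∧ ∀ z ∈ K, ⟪ν, z - x⟫ ≤ (0:ℝ)

def gaussPre (K : Set E3) (ω : Set E3) : Set E3 :=
  {x ∈ frontier K | ∃ ν ∈ ω, outerNormalAt K x ν}

def coneOver (G : Set E3) : Set E3 := {y | ∃ x ∈ G, ∃ t ∈ Set.Icc (0:ℝ) 1, y = t • x}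

def SolvesLMP (K : Set E3) (f : E3 → ℝ) : Prop :=
  ∀ ω : Set E3, ω ⊆ unitSphere → MeasurableSet ω →
    3 * (volume (coneOver (gaussPre K ω))).toReal = ∫ u in ω, f u ∂(μH[2])

def sphSupNorm (f : E3 → ℝ) : ℝ := sSup {c | ∃ x ∈ unitSphere, c = |f x|}

def sphHolderSemi (α : ℝ) (f : E3 → ℝ) : ℝ :=
  sSup {c | ∃ x ∈ unitSphere, ∃ y ∈ unitSphere, x ≠ y ∧ c = |f x - f y| / ‖x - y‖ ^ α}

def sphHolderNorm (α : ℝ) (f : E3 → ℝ) : ℝ := sphSupNorm f + sphHolderSemi α f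

def IsEllipsoid (E : Set E3) (c : E3) (e : Fin 3 → E3) (r : Fin 3 → ℝ) : Prop :=
  (∀ i, 0 < r i) ∧ Orthonormal ℝ e ∧
  E = {x : E3 | (∑ i, (⟪x - c, e i⟫ / r i) ^ 2) ≤ 1}

def dilate (c : E3) (s : ℝ) (A : Set E3) : Set E3 := (fun x => c + s • (x - c)) '' A

def centerOfMass (K : Set E3) : E3 := ((volume K).toReal)⁻¹ • ∫ x in K, x

/-- `E ⊆ K ⊆ 3^{3/2} E`, the dilation taken about the center `c` of `E`. -/
def IsJohnEllipsoid (K E : Set E3) (c : E3) : Prop :=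
  E ⊆ K ∧ K ⊆ dilate c ((3:ℝ) ^ ((3:ℝ) / 2)) E


/-! ## Elementary facts on convex bodies -/

lemma exit_point {K : Set E3} (hK : IsConvexBody K) {z : E3} (hz : z ∈ K) (hz0 : z ≠ 0) :
    ∃ τ : ℝ, 1 ≤ τ ∧ τ • z ∈ frontier K := by
  obtain ⟨hc, hcomp, _⟩ := hK
  let T : Set ℝ := {t : ℝ | 1 ≤ t ∧ t • z ∈ K}
  have hTcl : IsClosed T := by
    apply IsClosed.inter isClosed_Ici
    exact hcomp.isClosed.preimage (by fun_prop)
  have hzn : 0 < ‖z‖ := norm_pos_iff.2 hz0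
  obtain ⟨R, hR⟩ := hcomp.isBounded.exists_norm_le
  have hTb : BddAbove T := by
    refine ⟨R / ‖z‖, ?_⟩
    rintro t ⟨ht1, ht⟩
    have := hR _ ht
    rw [norm_smul, Real.norm_of_nonneg (by linarith)] at this
    rwa [le_div_iff₀ hzn]
  have hTne : T.Nonempty := ⟨1, le_rfl, by simpa using hz⟩
  have hmem := hTcl.csSup_mem hTne hTb
  refine ⟨sSup T, hmem.1, ?_⟩
  rw [frontier_eq_closure_inter_closure]
  refine ⟨subset_closure hmem.2, ?_⟩
  rw [mem_closure_iff_seq_limit]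
  refine ⟨fun n => (sSup T + 1 / ((n : ℝ) + 1)) • z, ?_, ?_⟩
  · intro n hn
    have hp : (0:ℝ) < 1 / ((n:ℝ) + 1) := by positivity
    have : sSup T + 1 / ((n : ℝ) + 1) ∈ T := ⟨by linarith [hmem.1], hn⟩
    have := le_csSup hTb this
    linarith
  · have h1 := tendsto_one_div_add_atTop_nhds_zero_nat (𝕜 := ℝ)
    have h2 := (h1.const_add (sSup T)).smul_const z
    simpa using h2

lemma exists_normal {K : Set E3} (hK : IsConvexBody K) {x : E3} (hx : x ∈ frontier K) :
    ∃ ν, outerNormalAt K x ν := by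
  obtain ⟨hc, hcomp, hne⟩ := hK
  have hxi : x ∉ interior K := hx.2
  obtain ⟨f, hf⟩ := geometric_hahn_banach_open_point hc.interior isOpen_interior hxi
  have hle : ∀ z ∈ K, f z ≤ f x := by
    intro z hz
    have h1 : z ∈ closure (interior K) := by
      rw [hc.closure_interior_eq_closure_of_nonempty_interior hne]; exact subset_closure hz
    exact closure_minimal (t := {z | f z ≤ f x}) (fun a ha => (hf a ha).le)
      (isClosed_le f.continuous continuous_const) h1
  let u := (InnerProductSpace.toDual ℝ E3).symm f
  have hu : ∀ y, ⟪u, y⟫ = f y := fun y => InnerProductSpace.toDual_symm_apply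
  obtain ⟨a, ha⟩ := hne
  have hu0 : u ≠ 0 := by
    intro h
    have := hf a ha
    rw [← hu, ← hu, h] at this
    simp at this
  refine ⟨‖u‖⁻¹ • u, ?_, ?_⟩
  · rw [norm_smul, norm_inv, norm_norm, inv_mul_cancel₀ (norm_ne_zero_iff.2 hu0)]
  · intro z hz
    rw [real_inner_smul_left, inner_sub_right, hu, hu]
    have := hle z hz
    have h2 : 0 ≤ ‖u‖⁻¹ := by positivity
    nlinarith

lemma subset_cone {K : Set E3} (hK : IsConvexBody K) :
    K ⊆ coneOver (gaussPre K unitSphere) := by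
  have key : ∀ z ∈ K, z ≠ 0 → z ∈ coneOver (gaussPre K unitSphere) := by
    intro z hz hz0
    obtain ⟨τ, h1, hf⟩ := exit_point hK hz hz0
    obtain ⟨ν, hν⟩ := exists_normal hK hf
    refine ⟨τ • z, ⟨hf, ν, by simpa [unitSphere] using hν.1, hν⟩, τ⁻¹, ⟨by positivity, ?_⟩, ?_⟩
    · exact inv_le_one_of_one_le₀ h1
    · rw [smul_smul, inv_mul_cancel₀ (by positivity), one_smul]
  intro z hz
  by_cases hz0 : z = 0
  · obtain ⟨a, ha⟩ := hK.2.2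
    have hex : ∃ a ∈ K, a ≠ 0 := by
      by_contra hcon
      push Not at hcon
      have : interior K ⊆ {0} := fun x hx => hcon x (interior_subset hx)
      have h2 : interior K = {0} := by
        apply Subset.antisymm this
        rintro _ rfl
        rw [← this ha]; exact ha
      have h3 : IsOpen ({0} : Set E3) := h2 ▸ isOpen_interior
      exact not_isOpen_singleton (0:E3) h3
    obtain ⟨a, ha, ha0⟩ := hex
    obtain ⟨x, hx, t, ht, _⟩ := key a ha ha0
    exact ⟨x, hx, 0, by simp, by simp [hz0]⟩
  · exact key z hz hz0

lemma cone_subset {K : Set E3} (hK : IsConvexBody K) (h0 : (0:E3) ∈ K) (ω : Set E3) :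
    coneOver (gaussPre K ω) ⊆ K := by
  rintro _ ⟨x, ⟨hx, _⟩, t, ht, rfl⟩
  have hxK : x ∈ K := hK.2.1.isClosed.frontier_subset hx
  exact (hK.1.starConvex h0).smul_mem hxK ht.1 ht.2

lemma gaussPre_compact {K : Set E3} (hK : IsConvexBody K) {ω : Set E3} (hω : IsCompact ω) :
    IsCompact (gaussPre K ω) := by
  have hfr : IsCompact (frontier K) := hK.2.1.of_isClosed_subset isClosed_frontier
    hK.2.1.isClosed.frontier_subset
  have hS : IsCompact ((frontier K ×ˢ ω) ∩ {p : E3 × E3 | outerNormalAt K p.1 p.2}) := by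
    apply (hfr.prod hω).inter_right
    have : {p : E3 × E3 | outerNormalAt K p.1 p.2} =
        {p | ‖p.2‖ = 1} ∩ ⋂ z ∈ K, {p | ⟪p.2, z - p.1⟫ ≤ (0:ℝ)} := by
      ext p; simp [outerNormalAt]
    rw [this]
    apply IsClosed.inter
    · exact isClosed_eq (by fun_prop) (by fun_prop)
    · exact isClosed_biInter fun z _ => isClosed_le (by fun_prop) (by fun_prop)
  have : gaussPre K ω =
      Prod.fst '' ((frontier K ×ˢ ω) ∩ {p : E3 × E3 | outerNormalAt K p.1 p.2}) := by
    ext x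
    constructor
    · rintro ⟨hx, ν, hν, h⟩
      exact ⟨(x, ν), ⟨⟨hx, hν⟩, h⟩, rfl⟩
    · rintro ⟨⟨x', ν⟩, ⟨⟨hx, hν⟩, h⟩, rfl⟩
      exact ⟨hx, ν, hν, h⟩
  rw [this]
  exact hS.image continuous_fst

/-! ## Comparison of cone volumes with two different apexes -/

/-- The cone over the inverse Gauss image, with apex `c` (translated to the origin). -/
def dcone (K : Set E3) (c : E3) (ω : Set E3) : Set E3 :=
  coneOver ((fun x => x - c) '' gaussPre K ω)

lemma coneOver_compact {G : Set E3} (hG : IsCompact G) : IsCompact (coneOver G) := by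
  have : coneOver G = (fun p : ℝ × E3 => p.1 • p.2) '' (Set.Icc (0:ℝ) 1 ×ˢ G) := by
    ext y
    constructor
    · rintro ⟨x, hx, t, ht, rfl⟩
      exact ⟨(t, x), ⟨ht, hx⟩, rfl⟩
    · rintro ⟨⟨t, x⟩, ⟨ht, hx⟩, rfl⟩
      exact ⟨x, hx, t, ht, rfl⟩
  rw [this]
  exact (isCompact_Icc.prod hG).image (by fun_prop)

lemma dcone_compact {K : Set E3} (hK : IsConvexBody K) (c : E3) {ω : Set E3} (hω : IsCompact ω) :
    IsCompact (dcone K c ω) :=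
  coneOver_compact ((gaussPre_compact hK hω).image (by fun_prop))

/-- gauge of `K - c` -/
def gg (K : Set E3) (c : E3) : E3 → ℝ := gauge ((fun y => c + y) ⁻¹' K)

lemma normal_height {K : Set E3} {c : E3} {ρ : ℝ} (hρ : 0 < ρ)
    (hb : Metric.closedBall c ρ ⊆ K) {x ν : E3} (h : outerNormalAt K x ν) :
    0 < ⟪ν, x - c⟫ := by
  have h1 := h.2 (c + ρ • ν) (hb (by simp [norm_smul, h.1, abs_of_pos hρ]))
  have h2 : ⟪ν, c + ρ • ν - x⟫ = ρ - ⟪ν, x - c⟫ := by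
    rw [show c + ρ • ν - x = ρ • ν - (x - c) by abel, inner_sub_right, real_inner_smul_right,
      real_inner_self_eq_norm_sq, h.1]
    ring
  linarith

lemma gg_lip {K : Set E3} (hK : IsConvexBody K) {c : E3} {ρ : ℝ} (hρ : 0 < ρ)
    (hb : Metric.closedBall c ρ ⊆ K) : ∃ C, LipschitzWith C (gg K c) := by
  refine ⟨_, Convex.lipschitzWith_gauge (r := ⟨ρ, hρ.le⟩) ?_ ?_ ?_⟩
  · exact hK.1.translate_preimage_right c
  · exact hρ
  · intro y hy
    apply hb
    simp at hy ⊢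
    exact hy.le

lemma gg_lower {K : Set E3} {c : E3} {ρ : ℝ} (hρ : 0 < ρ)
    (hb : Metric.closedBall c ρ ⊆ K) {x ν : E3} (h : outerNormalAt K x ν) (y : E3) :
    ⟪ν, y⟫ / ⟪ν, x - c⟫ ≤ gg K c y := by
  have hh := normal_height hρ hb h
  by_contra hcon
  push Not at hcon
  have habs : Absorbent ℝ ((fun y => c + y) ⁻¹' K) := by
    apply absorbent_nhds_zero
    apply mem_of_superset (Metric.closedBall_mem_nhds 0 hρ)
    intro y hy
    apply hb
    simpa using hy
  obtain ⟨b, hb0, hba, z, hz, rfl⟩ := exists_lt_of_gauge_lt habs hcon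
  have h1 := h.2 (c + z) hz
  rw [show c + z - x = z - (x - c) by abel, inner_sub_right] at h1
  simp only [real_inner_smul_right] at hba
  rw [lt_div_iff₀ hh] at hba
  nlinarith

lemma gg_at {K : Set E3} {c : E3} {ρ : ℝ} (hρ : 0 < ρ)
    (hb : Metric.closedBall c ρ ⊆ K) {x ν : E3} (hx : x ∈ K) (h : outerNormalAt K x ν)
    {t : ℝ} (ht : 0 ≤ t) : gg K c (t • (x - c)) = t := by
  have hh := normal_height hρ hb h
  have h1 : gg K c (x - c) = 1 := by
    apply le_antisymm
    · exact gauge_le_one_of_mem (by simpa using hx)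
    · have := gg_lower hρ hb h (x - c)
      rwa [div_self hh.ne'] at this
  unfold gg at *
  rw [gauge_smul_of_nonneg ht, h1]; simp

lemma gg_fderiv {K : Set E3} {c : E3} {ρ : ℝ} (hρ : 0 < ρ)
    (hb : Metric.closedBall c ρ ⊆ K) {x ν : E3} (hx : x ∈ K) (h : outerNormalAt K x ν)
    {t : ℝ} (ht : 0 ≤ t) (hd : DifferentiableAt ℝ (gg K c) (t • (x - c))) :
    ∀ y, fderiv ℝ (gg K c) (t • (x - c)) y = ⟪ν, y⟫ / ⟪ν, x - c⟫ := by
  have hh := normal_height hρ hb h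
  have hmin : IsLocalMin (fun y => gg K c y - (⟪ν, x - c⟫⁻¹ • innerSL ℝ ν) y) (t • (x - c)) := by
    apply Filter.Eventually.of_forall
    intro y
    have h1 := gg_lower hρ hb h y
    have h2 := gg_at hρ hb hx h ht
    have h3 : (⟪ν, x - c⟫⁻¹ • innerSL ℝ ν) (t • (x - c)) = t := by
      simp
      field_simp
    simp only [h2, h3, sub_self]
    simp only [smul_apply, innerSL_apply_apply, smul_eq_mul]
    rw [div_eq_inv_mul] at h1
    linarith
  have hD := hd.hasFDerivAt.sub (⟪ν, x - c⟫⁻¹ • innerSL ℝ ν).hasFDerivAt (x := t • (x - c))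
  have h0 := hmin.hasFDerivAt_eq_zero hD
  intro y
  rw [sub_eq_zero] at h0
  rw [h0]
  simp [div_eq_inv_mul]

lemma null_image {Φ : E3 → E3} {C : ℝ≥0} (hΦ : LipschitzWith C Φ) {s : Set E3}
    (hs : volume s = 0) : volume (Φ '' s) = 0 := by
  have hH : (μH[(3:ℝ)] : Measure E3).IsAddHaarMeasure := by
    simpa using MeasureTheory.isAddHaarMeasure_hausdorffMeasure (E := E3)
  have h1 : (μH[(3:ℝ)] : Measure E3) ≪ volume := Measure.absolutelyContinuous_isAddHaarMeasure _ _
  have h2 : volume ≪ (μH[(3:ℝ)] : Measure E3) := Measure.absolutelyContinuous_isAddHaarMeasure _ _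
  apply h2
  have := hΦ.hausdorffMeasure_image_le (d := 3) (by norm_num) s
  rw [h1 hs, mul_zero] at this
  exact le_antisymm this bot_le

lemma cone_compare {K : Set E3} (hK : IsConvexBody K) {c : E3} {ρ : ℝ} (hρ : 0 < ρ)
    (hb : Metric.closedBall c ρ ⊆ K) {ω : Set E3} (hω : IsCompact ω) {A : ℝ}
    (hA : ∀ x ∈ K, ∀ ν ∈ ω, outerNormalAt K x ν → |⟪ν, x⟫| ≤ A * ⟪ν, x - c⟫) :
    volume (coneOver (gaussPre K ω)) ≤ ENNReal.ofReal A * volume (dcone K c ω) := by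
  obtain ⟨C, hC⟩ := gg_lip hK hρ hb
  let Φ : E3 → E3 := fun w => w + gg K c w • c
  have hΦ : ∃ C', LipschitzWith C' Φ := by
    have hl : LipschitzWith ‖ContinuousLinearMap.toSpanSingleton ℝ c‖₊ (fun t : ℝ => t • c) :=
      (ContinuousLinearMap.toSpanSingleton ℝ c).lipschitz
    exact ⟨_, LipschitzWith.id.add (hl.comp hC)⟩
  obtain ⟨C', hC'⟩ := hΦ
  let D := dcone K c ω
  have hDm : MeasurableSet D := (dcone_compact hK c hω).measurableSet
  let B : Set E3 := {w | DifferentiableAt ℝ (gg K c) w}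
  have hBm : MeasurableSet B := measurableSet_of_differentiableAt ℝ _
  have hB0 : volume Bᶜ = 0 := hC.ae_differentiableAt
  have himg : coneOver (gaussPre K ω) ⊆ Φ '' D := by
    rintro _ ⟨x, hx, t, ht, rfl⟩
    refine ⟨t • (x - c), ⟨x - c, ⟨x, hx, rfl⟩, t, ht, rfl⟩, ?_⟩
    obtain ⟨hxf, ν, hν, h⟩ := hx
    have hxK : x ∈ K := hK.2.1.isClosed.frontier_subset hxf
    simp only [Φ, gg_at hρ hb hxK h ht.1]
    rw [← smul_add]; simp
  have hsplit : Φ '' D ⊆ Φ '' (D ∩ B) ∪ Φ '' Bᶜ := by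
    rw [← image_union]
    apply image_mono
    intro w hw
    by_cases hwB : w ∈ B
    · exact Or.inl ⟨hw, hwB⟩
    · exact Or.inr hwB
  have hder : ∀ w ∈ D ∩ B, HasFDerivWithinAt Φ
      (ContinuousLinearMap.id ℝ E3 + (fderiv ℝ (gg K c) w).smulRight c) (D ∩ B) w := by
    intro w hw
    have h1 : DifferentiableAt ℝ (gg K c) w := hw.2
    exact ((hasFDerivAt_id w).add (h1.hasFDerivAt.smul_const c)).hasFDerivWithinAt
  calc volume (coneOver (gaussPre K ω)) ≤ volume (Φ '' (D ∩ B) ∪ Φ '' Bᶜ) :=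
        measure_mono (himg.trans hsplit)
    _ ≤ volume (Φ '' (D ∩ B)) + volume (Φ '' Bᶜ) := measure_union_le _ _
    _ = volume (Φ '' (D ∩ B)) := by rw [null_image hC' hB0, add_zero]
    _ ≤ ∫⁻ w in D ∩ B, ENNReal.ofReal
        |(ContinuousLinearMap.id ℝ E3 + (fderiv ℝ (gg K c) w).smulRight c).det| :=
        addHaar_image_le_lintegral_abs_det_fderiv _ (hDm.inter hBm) hder
    _ ≤ ∫⁻ w in D ∩ B, ENNReal.ofReal A := by
        apply setLIntegral_mono measurable_const
        rintro w ⟨⟨_, ⟨x, ⟨hxf, ν, hν, h⟩, rfl⟩, t, ht, rfl⟩, hwB⟩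
        have hxK : x ∈ K := hK.2.1.isClosed.frontier_subset hxf
        apply ENNReal.ofReal_le_ofReal
        have hdet : (ContinuousLinearMap.id ℝ E3 +
            (fderiv ℝ (gg K c) (t • (x - c))).smulRight c).det
            = 1 + fderiv ℝ (gg K c) (t • (x - c)) c := by
          have := LinearMap.transvection.det
            (fderiv ℝ (gg K c) (t • (x - c)) : E3 →ₗ[ℝ] ℝ) c
          rw [ContinuousLinearMap.det]
          exact this
        have hh := normal_height hρ hb h
        simp only [hdet, gg_fderiv hρ hb hxK h ht.1 hwB]
        have h3 : 1 + ⟪ν, c⟫ / ⟪ν, x - c⟫ = ⟪ν, x⟫ / ⟪ν, x - c⟫ := by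
          field_simp
          rw [← inner_add_right]; simp
        rw [h3, abs_div, abs_of_pos hh, div_le_iff₀ hh]
        exact hA x hxK ν hν h
    _ = ENNReal.ofReal A * volume (D ∩ B) := by simp
    _ ≤ ENNReal.ofReal A * volume D := by gcongr; exact inter_subset_left

lemma dcone_aedisjoint {K : Set E3} (hK : IsConvexBody K) {c : E3} {ρ : ℝ} (hρ : 0 < ρ)
    (hb : Metric.closedBall c ρ ⊆ K) {ω ω' : Set E3} (hd : Disjoint ω ω') :
    AEDisjoint volume (dcone K c ω) (dcone K c ω') := by
  obtain ⟨C, hC⟩ := gg_lip hK hρ hb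
  have hB0 : volume {w | ¬ DifferentiableAt ℝ (gg K c) w} = 0 := hC.ae_differentiableAt
  refine measure_mono_null ?_ hB0
  rintro w ⟨⟨_, ⟨x, ⟨hxf, ν, hν, h⟩, rfl⟩, t, ht, rfl⟩,
    ⟨_, ⟨x', ⟨hxf', ν', hν', h'⟩, rfl⟩, t', ht', heq⟩⟩
  intro hdiff
  have hxK : x ∈ K := hK.2.1.isClosed.frontier_subset hxf
  have hxK' : x' ∈ K := hK.2.1.isClosed.frontier_subset hxf'
  have e1 := gg_fderiv hρ hb hxK h ht.1 hdiff
  have e2 : ∀ y, fderiv ℝ (gg K c) (t • (x - c)) y = ⟪ν', y⟫ / ⟪ν', x' - c⟫ := by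
    rw [heq] at hdiff ⊢
    exact gg_fderiv hρ hb hxK' h' ht'.1 hdiff
  have p1 := normal_height hρ hb h
  have p2 := normal_height hρ hb h'
  have e3 : ⟪ν, x - c⟫⁻¹ • ν = ⟪ν', x' - c⟫⁻¹ • ν' := by
    apply ext_inner_right ℝ
    intro y
    rw [real_inner_smul_left, real_inner_smul_left, ← div_eq_inv_mul, ← div_eq_inv_mul,
      ← e1, ← e2]
  have e4 : ⟪ν, x - c⟫⁻¹ = ⟪ν', x' - c⟫⁻¹ := by
    have := congrArg norm e3
    rw [norm_smul, norm_smul, h.1, h'.1, mul_one, mul_one, norm_inv, norm_inv,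
      Real.norm_of_nonneg p1.le, Real.norm_of_nonneg p2.le] at this
    exact this
  rw [e4] at e3
  have e5 : ν = ν' := smul_right_injective _ (inv_pos.2 p2).ne' e3
  exact Set.disjoint_left.1 hd hν (e5 ▸ hν')

lemma dcone_subset {K : Set E3} (hK : IsConvexBody K) {c : E3} (hc : c ∈ K) (ω : Set E3) :
    dcone K c ω ⊆ (fun y => c + y) ⁻¹' K := by
  rintro _ ⟨_, ⟨x, ⟨hxf, _⟩, rfl⟩, t, ht, rfl⟩
  have hxK : x ∈ K := hK.2.1.isClosed.frontier_subset hxf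
  have := hK.1 hc hxK (sub_nonneg.2 ht.2) ht.1 (by ring)
  show c + t • (x - c) ∈ K
  convert this using 1
  rw [smul_sub, sub_smul, one_smul]; abel

lemma dcone_sum {K : Set E3} (hK : IsConvexBody K) {c : E3} {ρ : ℝ} (hρ : 0 < ρ)
    (hb : Metric.closedBall c ρ ⊆ K) (ω : ℕ → Set E3) (hω : ∀ k, IsCompact (ω k))
    (hd : Pairwise (Function.onFun Disjoint ω)) (N : ℕ) :
    ∑ k ∈ Finset.range N, volume (dcone K c (ω k)) ≤ volume K := by
  rw [← measure_biUnion_finset₀]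
  · calc volume (⋃ k ∈ Finset.range N, dcone K c (ω k)) ≤ volume ((fun y => c + y) ⁻¹' K) := by
          apply measure_mono
          apply iUnion₂_subset
          intro k _
          exact dcone_subset hK (hb (Metric.mem_closedBall_self hρ.le)) _
      _ = volume K := measure_preimage_add _ _ _
  · intro i _ j _ hij
    exact dcone_aedisjoint hK hρ hb (hd hij)
  · intro k _
    exact (dcone_compact hK c (hω k)).measurableSet.nullMeasurableSet

/-! ## Measure estimates -/

lemma box_volume (b : OrthonormalBasis (Fin 3) ℝ E3) (p : E3) (a : Fin 3 → ℝ)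
    (ha : ∀ i, 0 ≤ a i) :
    volume {x : E3 | ∀ i, |⟪x - p, b i⟫| ≤ a i} = ENNReal.ofReal (8 * (a 0 * a 1 * a 2)) := by
  have h1 : {x : E3 | ∀ i, |⟪x - p, b i⟫| ≤ a i} =
      (fun x => x - p) ⁻¹' (b.repr ⁻¹' ((WithLp.ofLp : E3 → (Fin 3 → ℝ)) ⁻¹'
        (Set.Icc (-a) a))) := by
    ext x
    simp only [mem_ofPred_eq, mem_preimage, mem_Icc, Pi.le_def, Pi.neg_apply, ← forall_and,
      ← abs_le, b.repr_apply_apply]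
    simp only [real_inner_comm]
  have hm : MeasurableSet ((WithLp.ofLp : E3 → (Fin 3 → ℝ)) ⁻¹' (Set.Icc (-a) a)) :=
    (PiLp.continuous_ofLp 2 _).measurable measurableSet_Icc
  have hm2 : MeasurableSet (b.repr ⁻¹' ((WithLp.ofLp : E3 → (Fin 3 → ℝ)) ⁻¹'
      (Set.Icc (-a) a))) := b.repr.continuous.measurable hm
  rw [h1, (measurePreserving_sub_right volume p).measure_preimage hm2.nullMeasurableSet,
    b.measurePreserving_repr.measure_preimage hm.nullMeasurableSet,
    (PiLp.volume_preserving_ofLp (Fin 3)).measure_preimage measurableSet_Icc.nullMeasurableSet,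
    Real.volume_Icc_pi]
  simp only [Pi.neg_apply, sub_neg_eq_add, Fin.prod_univ_three]
  rw [← ENNReal.ofReal_mul (by linarith [ha 0]), ← ENNReal.ofReal_mul]
  · congr 1; ring
  · have := ha 0; have := ha 1; positivity

/-- a strip on the sphere -/
def strip (b : OrthonormalBasis (Fin 3) ℝ E3) (α β : ℝ) : Set E3 :=
  {u | u ∈ unitSphere ∧ |⟪u, b 0⟫| ≤ 1 / 2 ∧ α ≤ ⟪u, b 1⟫ ∧ ⟪u, b 1⟫ ≤ β ∧ 0 ≤ ⟪u, b 2⟫}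

/-- two opposite caps on the sphere -/
def cap (b : OrthonormalBasis (Fin 3) ℝ E3) (η : ℝ) : Set E3 :=
  {u | u ∈ unitSphere ∧ ⟪u, b 1⟫ ^ 2 + ⟪u, b 2⟫ ^ 2 ≤ η ^ 2}

lemma unitSphere_compact : IsCompact unitSphere := isCompact_sphere _ _

lemma strip_compact (b : OrthonormalBasis (Fin 3) ℝ E3) (α β : ℝ) : IsCompact (strip b α β) := by
  have h : strip b α β = unitSphere ∩ ({u | |⟪u, b 0⟫| ≤ 1 / 2} ∩ ({u | α ≤ ⟪u, b 1⟫} ∩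
      ({u | ⟪u, b 1⟫ ≤ β} ∩ {u | 0 ≤ ⟪u, b 2⟫}))) := by
    ext u; simp [strip]; tauto
  rw [h]
  apply unitSphere_compact.inter_right
  refine IsClosed.inter (isClosed_le (by fun_prop) (by fun_prop)) ?_
  refine IsClosed.inter (isClosed_le (by fun_prop) (by fun_prop)) ?_
  exact IsClosed.inter (isClosed_le (by fun_prop) (by fun_prop))
    (isClosed_le (by fun_prop) (by fun_prop))

lemma cap_compact (b : OrthonormalBasis (Fin 3) ℝ E3) (η : ℝ) : IsCompact (cap b η) := by
  have h : cap b η = unitSphere ∩ {u | ⟪u, b 1⟫ ^ 2 + ⟪u, b 2⟫ ^ 2 ≤ η ^ 2} := by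
    ext u; simp [cap]
  rw [h]
  apply unitSphere_compact.inter_right
  exact isClosed_le (by fun_prop) (by fun_prop)

lemma inner_coord (b : OrthonormalBasis (Fin 3) ℝ E3) (x y : E3) :
    ⟪x, y⟫ = ⟪x, b 0⟫ * ⟪y, b 0⟫ + ⟪x, b 1⟫ * ⟪y, b 1⟫ + ⟪x, b 2⟫ * ⟪y, b 2⟫ := by
  rw [← b.sum_inner_mul_inner x y, Fin.sum_univ_three]
  simp only [real_inner_comm]

lemma norm_coord (b : OrthonormalBasis (Fin 3) ℝ E3) (x : E3) :
    ‖x‖ ^ 2 = ⟪x, b 0⟫ ^ 2 + ⟪x, b 1⟫ ^ 2 + ⟪x, b 2⟫ ^ 2 := by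
  rw [← real_inner_self_eq_norm_sq, inner_coord b]; ring

lemma bb (b : OrthonormalBasis (Fin 3) ℝ E3) (i j : Fin 3) :
    ⟪b i, b j⟫ = if i = j then (1:ℝ) else 0 := b.inner_eq_ite i j

lemma strip_measure (b : OrthonormalBasis (Fin 3) ℝ E3) {α β : ℝ} (hα : 0 ≤ α)
    (hβ : β ≤ 1 / 2) : ENNReal.ofReal (β - α) ≤ μH[2] (strip b α β) := by
  let P : E3 → (Fin 2 → ℝ) := fun u => ![⟪u, b 0⟫, ⟪u, b 1⟫]
  have hP : LipschitzWith 1 P := by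
    rw [lipschitzWith_iff_dist_le_mul]
    intro x y
    rw [dist_pi_le_iff (by positivity)]
    intro i
    have hn : ∀ j, ‖b j‖ = 1 := fun j => b.orthonormal.1 j
    have key : ∀ j, dist ⟪x, b j⟫ ⟪y, b j⟫ ≤ dist x y := by
      intro j
      rw [Real.dist_eq, ← inner_sub_left, dist_eq_norm]
      have := abs_real_inner_le_norm (x - y) (b j)
      rwa [hn, mul_one] at this
    fin_cases i
    · simpa [P] using key 0
    · simpa [P] using key 1
  have h1 := hP.hausdorffMeasure_image_le (d := 2) (by norm_num) (strip b α β)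
  have h2 : Set.Icc (![-(1/2), α] : Fin 2 → ℝ) ![1/2, β] ⊆ P '' strip b α β := by
    rintro y ⟨hy1, hy2⟩
    have a0 := hy1 0
    have a1 := hy1 1
    have a2 := hy2 0
    have a3 := hy2 1
    simp at a0 a1 a2 a3
    have hsq : 0 ≤ 1 - y 0 ^ 2 - y 1 ^ 2 := by nlinarith
    let u : E3 := y 0 • b 0 + y 1 • b 1 + √(1 - y 0 ^ 2 - y 1 ^ 2) • b 2
    have u0 : ⟪u, b 0⟫ = y 0 := by simp [u, inner_add_left, real_inner_smul_left]
    have u1 : ⟪u, b 1⟫ = y 1 := by simp [u, inner_add_left, real_inner_smul_left]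
    have u2 : ⟪u, b 2⟫ = √(1 - y 0 ^ 2 - y 1 ^ 2) := by
      simp [u, inner_add_left, real_inner_smul_left]
    refine ⟨u, ⟨?_, ?_, ?_, ?_, ?_⟩, ?_⟩
    · have h3 : ‖u‖ ^ 2 = 1 := by
        rw [norm_coord b, u0, u1, u2, Real.sq_sqrt hsq]; ring
      have : ‖u‖ = 1 := by
        nlinarith [norm_nonneg u]
      simpa [unitSphere] using this
    · rw [u0, abs_le]; constructor <;> linarith
    · rw [u1]; exact a1
    · rw [u1]; exact a3
    · rw [u2]; positivity
    · ext i
      fin_cases i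
      · exact u0
      · exact u1
  have h3 : (μH[2] : Measure (Fin 2 → ℝ)) = volume := by
    have := hausdorffMeasure_pi_real (ι := Fin 2)
    simpa using this
  have h4 : ENNReal.ofReal (β - α) = volume (Set.Icc (![-(1/2), α] : Fin 2 → ℝ) ![1/2, β]) := by
    rw [Real.volume_Icc_pi]
    simp only [Fin.prod_univ_two, Matrix.cons_val_zero, Matrix.cons_val_one]
    norm_num
  rw [h4, ← h3]
  refine (measure_mono h2).trans (h1.trans ?_)
  simp

lemma cap_small (hfin : μH[2] unitSphere ≠ ⊤) {ε : ℝ≥0∞} (hε : 0 < ε) :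
    ∃ η > 0, ∀ b : OrthonormalBasis (Fin 3) ℝ E3, ∀ η' : ℝ, 0 ≤ η' → η' ≤ η →
      μH[2] (cap b η') ≤ ε := by
  let b₀ : OrthonormalBasis (Fin 3) ℝ E3 := EuclideanSpace.basisFun (Fin 3) ℝ
  let s : ℕ → Set E3 := fun n => cap b₀ (1 / ((n:ℝ) + 1))
  have hmono : ∀ (b : OrthonormalBasis (Fin 3) ℝ E3) {x y : ℝ}, 0 ≤ x → x ≤ y →
      cap b x ⊆ cap b y := by
    rintro b x y hx hxy u ⟨h1, h2⟩
    exact ⟨h1, h2.trans (by gcongr)⟩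
  have hanti : Antitone s := by
    intro m n hmn
    apply hmono _ (by positivity)
    gcongr
  have hlim := tendsto_measure_iInter_atTop (μ := (μH[2] : Measure E3)) (s := s)
    (fun n => (cap_compact _ _).measurableSet.nullMeasurableSet) hanti
    ⟨0, ne_top_of_le_ne_top hfin (measure_mono fun u hu => hu.1)⟩
  have hzero : μH[2] (⋂ n, s n) = 0 := by
    have hsub : (⋂ n, s n) ⊆ {b₀ 0, - b₀ 0} := by
      intro u hu
      rw [mem_iInter] at hu
      have hun : ‖u‖ = 1 := by simpa [unitSphere] using (hu 0).1
      have h1 : ⟪u, b₀ 1⟫ ^ 2 + ⟪u, b₀ 2⟫ ^ 2 ≤ 0 := by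
        have ht := (tendsto_one_div_add_atTop_nhds_zero_nat (𝕜 := ℝ)).pow 2
        rw [zero_pow (by norm_num)] at ht
        exact ge_of_tendsto' ht fun n => (hu n).2
      have h2 : ⟪u, b₀ 1⟫ = 0 := by nlinarith [sq_nonneg ⟪u, b₀ 1⟫, sq_nonneg ⟪u, b₀ 2⟫]
      have h3 : ⟪u, b₀ 2⟫ = 0 := by nlinarith [sq_nonneg ⟪u, b₀ 1⟫, sq_nonneg ⟪u, b₀ 2⟫]
      have h4 := norm_coord b₀ u
      rw [hun, h2, h3] at h4
      have h5 : u = ⟪u, b₀ 0⟫ • b₀ 0 := by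
        have := b₀.sum_repr' u
        rw [Fin.sum_univ_three, real_inner_comm, real_inner_comm u (b₀ 1),
          real_inner_comm u (b₀ 2), h2, h3] at this
        simpa using this.symm
      have h6 : ⟪u, b₀ 0⟫ = 1 ∨ ⟪u, b₀ 0⟫ = -1 := by
        have h7 : (⟪u, b₀ 0⟫ - 1) * (⟪u, b₀ 0⟫ + 1) = 0 := by linarith
        rcases mul_eq_zero.1 h7 with h | h
        · left; linarith
        · right; linarith
      rcases h6 with h6 | h6
      · left; rw [h5, h6, one_smul]
      · right; rw [h5, h6]; simp
    have : NullSingletonClass (μH[2] : Measure E3) :=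
      Measure.nullSingletonClass_hausdorff _ (by norm_num)
    exact measure_mono_null hsub (Set.Finite.measure_zero (by simp) _)
  rw [hzero] at hlim
  obtain ⟨n, hn⟩ := ((tendsto_order.1 hlim).2 ε hε).exists
  refine ⟨1 / ((n:ℝ) + 1), by positivity, ?_⟩
  intro b η' hη0 hη
  let T : E3 ≃ₗᵢ[ℝ] E3 := b.equiv b₀ (Equiv.refl _)
  have hT : T '' cap b η' ⊆ cap b₀ η' := by
    rintro _ ⟨u, ⟨h1, h2⟩, rfl⟩
    have h3 : ∀ i, ⟪T u, b₀ i⟫ = ⟪u, b i⟫ := by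
      intro i
      have : b₀ i = T (b i) := by simp [T]
      rw [this, T.inner_map_map]
    refine ⟨?_, ?_⟩
    · have : ‖u‖ = 1 := by simpa [unitSphere] using h1
      simp [unitSphere, this]
    · rw [h3, h3]; exact h2
  calc μH[2] (cap b η') = μH[2] (T '' cap b η') :=
        (T.toIsometryEquiv.hausdorffMeasure_image 2 _).symm
    _ ≤ μH[2] (s n) := measure_mono (hT.trans (hmono _ hη0 hη))
    _ ≤ ε := hn.le

lemma lmp_bounds {lam : ℝ} (hlam : 1 < lam) {f : E3 → ℝ} {K : Set E3}
    (hf : ∀ u ∈ unitSphere, 1 / lam < f u ∧ f u < lam)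
    (hK : IsConvexBody K) (h0 : (0:E3) ∈ K) (hs : SolvesLMP K f) :
    μH[2] unitSphere ≠ ⊤ ∧ ∀ ω : Set E3, ω ⊆ unitSphere → MeasurableSet ω →
      (μH[2] ω).toReal / lam ≤ 3 * (volume (coneOver (gaussPre K ω))).toReal ∧
      3 * (volume (coneOver (gaussPre K ω))).toReal ≤ lam * (μH[2] ω).toReal := by
  have hm : MeasurableSet unitSphere := unitSphere_compact.measurableSet
  have hKfin : volume K ≠ ⊤ := hK.2.1.measure_lt_top.ne
  have hfInt : IntegrableOn f unitSphere μH[2] := by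
    by_contra hcon
    have h1 := hs unitSphere subset_rfl hm
    rw [integral_undef hcon] at h1
    have hpos : 0 < volume K := by
      refine lt_of_lt_of_le (isOpen_interior.measure_pos volume hK.2.2)
        (measure_mono interior_subset)
    have h2 : volume K ≤ volume (coneOver (gaussPre K unitSphere)) :=
      measure_mono (subset_cone hK)
    have h3 : volume (coneOver (gaussPre K unitSphere)) ≠ ⊤ :=
      ne_top_of_le_ne_top hKfin (measure_mono (cone_subset hK h0 _))
    have := ENNReal.toReal_pos (lt_of_lt_of_le hpos h2).ne' h3
    linarith
  have hfin : μH[2] unitSphere ≠ ⊤ := by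
    have hl : 0 < 1 / lam := by positivity
    have := Integrable.measure_norm_ge_lt_top hfInt hl
    refine ne_top_of_le_ne_top this.ne ?_
    rw [Measure.restrict_apply' hm]
    apply measure_mono
    intro u hu
    refine ⟨?_, hu⟩
    exact (hf u hu).1.le.trans (le_abs_self _)
  refine ⟨hfin, ?_⟩
  intro ω hω hωm
  have hωfin : μH[2] ω ≠ ⊤ := ne_top_of_le_ne_top hfin (measure_mono hω)
  rw [hs ω hω hωm]
  have hi := hfInt.mono_set hω
  have c1 : ∫ u in ω, (1 / lam) ∂(μH[2]) = (μH[2] ω).toReal / lam := by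
    rw [setIntegral_const, smul_eq_mul, Measure.real]; ring
  have c2 : ∫ u in ω, lam ∂(μH[2]) = lam * (μH[2] ω).toReal := by
    rw [setIntegral_const, smul_eq_mul, Measure.real]; ring
  rw [← c1, ← c2]
  constructor
  · exact setIntegral_mono_on (integrableOn_const hωfin) hi hωm fun u hu => (hf u (hω hu)).1.le
  · exact setIntegral_mono_on hi (integrableOn_const hωfin) hωm fun u hu => (hf u (hω hu)).2.le

/-! ## The origin is not close to the lateral boundary -/

lemma stepC_ratio {K : Set E3} (h0 : (0:E3) ∈ K) {c : E3} (b : OrthonormalBasis (Fin 3) ℝ E3)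
    {r0 r1 r2 ε C₂ : ℝ} (hr1 : 0 < r1) (hr2 : 0 < r2)
    (hw : ∀ w : E3, ⟪w, b 0⟫ = 0 → ‖w‖ ≤ r1 → c + w ∈ K)
    (hx0 : ∀ x ∈ K, |⟪x, b 0⟫| ≤ 12 * r0) (hx : ∀ x ∈ K, ‖x‖ ≤ 12 * r2)
    (hx2 : ∀ x ∈ K, ⟪x, b 2⟫ ≤ ε * r2) (hε : r0 ≤ ε * r2) (hC : r2 ≤ C₂ * r1)
    {e : ℝ} (he : ε ≤ e) (he0 : 0 < e) {x ν : E3} (hxK : x ∈ K) (hν : ν ∈ strip b (e / 2) e)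
    (h : outerNormalAt K x ν) :
    |⟪ν, x⟫| ≤ (26 * e * C₂) * ⟪ν, x - c⟫ := by
  obtain ⟨-, a0, a1, a2, a3⟩ := hν
  have hνn := norm_coord b ν
  rw [h.1] at hνn
  have hpos : 0 ≤ ⟪ν, x⟫ := by
    have := h.2 0 h0
    rw [zero_sub, inner_neg_right] at this
    linarith
  -- upper bound of the support function
  have hup : ⟪ν, x⟫ ≤ 19 * e * r2 := by
    rw [inner_coord b]
    have b0 := hx0 x hxK
    have b1 : |⟪x, b 1⟫| ≤ 12 * r2 := by
      have := abs_real_inner_le_norm x (b 1)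
      rw [b.orthonormal.1 1, mul_one] at this
      exact this.trans (hx x hxK)
    have b2 := hx2 x hxK
    have t0 : ⟪ν, b 0⟫ * ⟪x, b 0⟫ ≤ 1 / 2 * (12 * r0) := by
      refine (le_abs_self _).trans ?_
      rw [abs_mul]
      gcongr
    have t1 : ⟪ν, b 1⟫ * ⟪x, b 1⟫ ≤ e * (12 * r2) := by
      refine (le_abs_self _).trans ?_
      rw [abs_mul, abs_of_nonneg (by linarith : 0 ≤ ⟪ν, b 1⟫)]
      gcongr
    have hν2 : ⟪ν, b 2⟫ ≤ 1 := by nlinarith [sq_nonneg ⟪ν, b 0⟫, sq_nonneg ⟪ν, b 1⟫]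
    have hee : ε * r2 ≤ e * r2 := by gcongr
    have t2 : ⟪ν, b 2⟫ * ⟪x, b 2⟫ ≤ e * r2 := by
      calc ⟪ν, b 2⟫ * ⟪x, b 2⟫ ≤ ⟪ν, b 2⟫ * (e * r2) := by gcongr; linarith
        _ ≤ 1 * (e * r2) := by gcongr
        _ = e * r2 := one_mul _
    nlinarith
  -- lower bound for the height over `c`
  have hlow : 3 / 4 * r1 ≤ ⟪ν, x - c⟫ := by
    let w : E3 := ν - ⟪ν, b 0⟫ • b 0
    have hw0 : ⟪w, b 0⟫ = 0 := by simp [w, inner_sub_left, real_inner_smul_left]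
    have hnw : ⟪ν, w⟫ = 1 - ⟪ν, b 0⟫ ^ 2 := by
      simp only [w, inner_sub_right, real_inner_smul_right, real_inner_self_eq_norm_sq, h.1]
      ring
    have hwn : ‖w‖ ^ 2 = 1 - ⟪ν, b 0⟫ ^ 2 := by
      rw [← real_inner_self_eq_norm_sq]
      nth_rewrite 1 [show w = ν - ⟪ν, b 0⟫ • b 0 from rfl]
      rw [inner_sub_left, hnw, real_inner_smul_left, real_inner_comm w (b 0), hw0]; ring
    have hw1 : ‖w‖ ≤ 1 := by nlinarith [norm_nonneg w, sq_nonneg ⟪ν, b 0⟫]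
    have hmem : c + r1 • w ∈ K := by
      apply hw
      · rw [real_inner_smul_left, hw0, mul_zero]
      · rw [norm_smul, Real.norm_of_nonneg hr1.le]
        nlinarith
    have h1 := h.2 _ hmem
    rw [show c + r1 • w - x = r1 • w - (x - c) by abel, inner_sub_right, real_inner_smul_right,
      hnw] at h1
    have h2 : ⟪ν, b 0⟫ ^ 2 ≤ 1 / 4 := by
      have := sq_le_sq' (by linarith [abs_nonneg ⟪ν, b 0⟫]) a0
      rw [sq_abs] at this
      linarith
    nlinarith
  rw [abs_of_nonneg hpos]
  have hCp : 0 < C₂ := by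
    by_contra hcon
    push Not at hcon
    nlinarith
  calc ⟪ν, x⟫ ≤ 19 * e * r2 := hup
    _ ≤ 19 * e * (C₂ * r1) := by gcongr
    _ ≤ (26 * e * C₂) * (3 / 4 * r1) := by
        have : 0 < e * C₂ * r1 := by positivity
        nlinarith
    _ ≤ _ := by gcongr

lemma stepC {K : Set E3} (hK : IsConvexBody K) (h0 : (0:E3) ∈ K) {c : E3}
    (b : OrthonormalBasis (Fin 3) ℝ E3)
    {r0 r1 r2 C₂ lam : ℝ} (hlam : 1 < lam) (hC0 : 0 < C₂) (hr1 : 0 < r1) (hr2 : 0 < r2) {ρ : ℝ}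
    (hρ : 0 < ρ) (hb : Metric.closedBall c ρ ⊆ K)
    (hV : ∀ ω : Set E3, ω ⊆ unitSphere → MeasurableSet ω →
      (μH[2] ω).toReal / lam ≤ 3 * (volume (coneOver (gaussPre K ω))).toReal ∧
      3 * (volume (coneOver (gaussPre K ω))).toReal ≤ lam * (μH[2] ω).toReal)
    (hfin : μH[2] unitSphere ≠ ⊤)
    {N : ℕ} (hN : 52 * lam ^ 2 * C₂ * (μH[2] unitSphere).toReal < N)
    (hw : ∀ w : E3, ⟪w, b 0⟫ = 0 → ‖w‖ ≤ r1 → c + w ∈ K)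
    (hx0 : ∀ x ∈ K, |⟪x, b 0⟫| ≤ 12 * r0) (hx : ∀ x ∈ K, ‖x‖ ≤ 12 * r2)
    (hx2 : ∀ x ∈ K, ⟪x, b 2⟫ ≤ (1 / 2 * (1 / 4) ^ N) * r2)
    (hε : r0 ≤ (1 / 2 * (1 / 4) ^ N) * r2) (hC : r2 ≤ C₂ * r1) : False := by
  let e : ℕ → ℝ := fun k => 1 / 2 * (1 / 4) ^ k
  let ω : ℕ → Set E3 := fun k => strip b (e k / 2) (e k)
  have he0 : ∀ k, 0 < e k := fun k => by positivity
  have hanti : ∀ {i j : ℕ}, i ≤ j → e j ≤ e i := by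
    intro i j hij
    have : ((1:ℝ) / 4) ^ j ≤ (1 / 4) ^ i := pow_le_pow_of_le_one (by norm_num) (by norm_num) hij
    simp only [e]; linarith
  have hKfin : volume K ≠ ⊤ := hK.2.1.measure_lt_top.ne
  have hdis : ∀ i j, i < j → Disjoint (ω i) (ω j) := by
    intro i j hij
    rw [Set.disjoint_left]
    intro u hu hu'
    have h1 := hu.2.2.1
    have h2 := hu'.2.2.2.1
    have h3 : e j ≤ e (i + 1) := hanti hij
    have h4 : e (i + 1) = e i / 4 := by simp only [e]; ring
    have := he0 i
    linarith
  have hd : Pairwise (Function.onFun Disjoint ω) := by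
    intro i j hij
    rcases lt_or_gt_of_ne hij with h | h
    · exact hdis i j h
    · exact (hdis j i h).symm
  have hsum := dcone_sum hK hρ hb ω (fun k => strip_compact _ _ _) hd N
  have hDle : ∀ k, volume (dcone K c (ω k)) ≤ volume K := by
    intro k
    calc _ ≤ volume ((fun y => c + y) ⁻¹' K) :=
          measure_mono (dcone_subset hK (hb (Metric.mem_closedBall_self hρ.le)) _)
      _ = volume K := measure_preimage_add _ _ _
  have hDfin : ∀ k, volume (dcone K c (ω k)) ≠ ⊤ := fun k => ne_top_of_le_ne_top hKfin (hDle k)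
  have hD : ∀ k ∈ Finset.range N, 1 / (156 * lam * C₂) ≤ (volume (dcone K c (ω k))).toReal := by
    intro k hk
    have hkN : k ≤ N := (Finset.mem_range.1 hk).le
    have h1 := cone_compare hK hρ hb (strip_compact b (e k / 2) (e k)) (A := 26 * e k * C₂)
      (fun x hxK ν hν h => stepC_ratio h0 b hr1 hr2 hw hx0 hx hx2 hε hC (hanti hkN) (he0 k)
        hxK hν h)
    have h2 : (volume (coneOver (gaussPre K (ω k)))).toReal ≤
        26 * e k * C₂ * (volume (dcone K c (ω k))).toReal := by
      have := ENNReal.toReal_mono (ENNReal.mul_ne_top ENNReal.ofReal_ne_top (hDfin k)) h1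
      rwa [ENNReal.toReal_mul, ENNReal.toReal_ofReal (by have := he0 k; positivity)] at this
    have hsub : ω k ⊆ unitSphere := fun u hu => hu.1
    have h3 := (hV (ω k) hsub (strip_compact _ _ _).measurableSet).1
    have h4 : e k / 2 ≤ (μH[2] (ω k)).toReal := by
      have hek : e k ≤ 1 / 2 := by
        have := hanti (Nat.zero_le k)
        simpa [e] using this
      have := strip_measure b (α := e k / 2) (β := e k) (by have := he0 k; positivity) hek
      have := ENNReal.toReal_mono (ne_top_of_le_ne_top hfin (measure_mono hsub)) this
      rw [ENNReal.toReal_ofReal (by linarith [he0 k])] at this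
      linarith
    have h5 : e k / 2 / lam ≤ 3 * (26 * e k * C₂ * (volume (dcone K c (ω k))).toReal) := by
      calc e k / 2 / lam ≤ (μH[2] (ω k)).toReal / lam := by gcongr
        _ ≤ _ := h3
        _ ≤ _ := by linarith
    rw [div_le_iff₀ (by positivity)]
    rw [div_le_iff₀ (by positivity)] at h5
    have := he0 k
    have h6 : e k * 1 ≤ e k * ((volume (dcone K c (ω k))).toReal * (156 * lam * C₂)) := by
      nlinarith
    exact le_of_mul_le_mul_left h6 this
  have h7 : (N : ℝ) * (1 / (156 * lam * C₂)) ≤ (volume K).toReal := by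
    have := ENNReal.toReal_mono hKfin hsum
    rw [ENNReal.toReal_sum (fun k _ => hDfin k)] at this
    refine le_trans ?_ this
    have := Finset.sum_le_sum hD
    simpa using this
  have h8 : 3 * (volume K).toReal ≤ lam * (μH[2] unitSphere).toReal := by
    refine le_trans ?_ (hV unitSphere subset_rfl unitSphere_compact.measurableSet).2
    have h3 : volume (coneOver (gaussPre K unitSphere)) ≠ ⊤ :=
      ne_top_of_le_ne_top hKfin (measure_mono (cone_subset hK h0 _))
    have := ENNReal.toReal_mono h3 (measure_mono (subset_cone hK))
    linarith
  have h9 : (N : ℝ) ≤ (volume K).toReal * (156 * lam * C₂) := by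
    rwa [mul_one_div, div_le_iff₀ (by positivity)] at h7
  have h10 : (volume K).toReal * (156 * lam * C₂) ≤ 52 * lam ^ 2 * C₂ * (μH[2] unitSphere).toReal := by
    have : 0 < lam * C₂ := by positivity
    nlinarith
  linarith

/-! ## The origin in the middle -/

lemma stepD_cap {K : Set E3} {c : E3} (b : OrthonormalBasis (Fin 3) ℝ E3)
    {r0 r2 ε : ℝ} (hr2 : 0 < r2) (hε : 0 < ε) (hr0 : 0 < r0)
    (hx0 : ∀ x ∈ K, |⟪x - c, b 0⟫| ≤ 6 * r0)
    (hsupp : ∀ u : E3, ‖u‖ = 1 → ⟪u, b 0⟫ = 0 → ∃ x ∈ K, ε * r2 ≤ ⟪u, x⟫)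
    {x ν : E3} (hx : x ∈ K) (h : outerNormalAt K x ν)
    (hp : ⟪x, b 1⟫ ^ 2 + ⟪x, b 2⟫ ^ 2 ≤ (ε * r2 / 2) ^ 2) :
    ν ∈ cap b (24 * r0 / (ε * r2)) := by
  refine ⟨by simpa [unitSphere] using h.1, ?_⟩
  let w : E3 := ν - ⟪ν, b 0⟫ • b 0
  have w0 : ⟪w, b 0⟫ = 0 := by simp [w, inner_sub_left, real_inner_smul_left]
  have w1 : ⟪w, b 1⟫ = ⟪ν, b 1⟫ := by simp [w, inner_sub_left, real_inner_smul_left]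
  have w2 : ⟪w, b 2⟫ = ⟪ν, b 2⟫ := by simp [w, inner_sub_left, real_inner_smul_left]
  have hwn := norm_coord b w
  rw [w0, w1, w2, zero_pow two_ne_zero, zero_add] at hwn
  rw [← hwn]
  by_cases hw : w = 0
  · rw [hw]; simp; positivity
  have hwp : 0 < ‖w‖ := norm_pos_iff.2 hw
  obtain ⟨z, hz, hzu⟩ := hsupp (‖w‖⁻¹ • w)
    (by rw [norm_smul, norm_inv, norm_norm, inv_mul_cancel₀ hwp.ne'])
    (by rw [real_inner_smul_left, w0, mul_zero])
  rw [real_inner_smul_left, inv_mul_eq_div, le_div_iff₀ hwp] at hzu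
  have hwx : ⟪w, x⟫ ≤ ‖w‖ * (ε * r2 / 2) := by
    let x' : E3 := x - ⟪x, b 0⟫ • b 0
    have e1 : ⟪w, x⟫ = ⟪w, x'⟫ := by
      simp only [x', inner_sub_right, real_inner_smul_right, w0]; ring
    have e2 : ‖x'‖ ^ 2 ≤ (ε * r2 / 2) ^ 2 := by
      rw [norm_coord b x']
      simp [x', inner_sub_left, real_inner_smul_left]
      exact hp
    have e3 : ‖x'‖ ≤ ε * r2 / 2 := le_of_sq_le_sq e2 (by positivity)
    rw [e1]
    exact (real_inner_le_norm _ _).trans (by gcongr)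
  have hn := h.2 z hz
  have hν : ∀ y, ⟪ν, y⟫ = ⟪w, y⟫ + ⟪ν, b 0⟫ * ⟪y, b 0⟫ := by
    intro y
    simp only [w, inner_sub_left, real_inner_smul_left]
    rw [real_inner_comm y (b 0)]; ring
  rw [hν, inner_sub_right] at hn
  have hb0 : |⟪ν, b 0⟫| ≤ 1 := by
    have := abs_real_inner_le_norm ν (b 0)
    rwa [h.1, b.orthonormal.1 0, mul_one] at this
  have hzx : |⟪z - x, b 0⟫| ≤ 12 * r0 := by
    have h1 := hx0 z hz
    have h2 := hx0 x hx
    rw [show z - x = (z - c) - (x - c) by abel, inner_sub_left]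
    rw [abs_le] at *
    constructor <;> linarith [h1.1, h1.2, h2.1, h2.2]
  have hprod : |⟪ν, b 0⟫ * ⟪z - x, b 0⟫| ≤ 12 * r0 := by
    rw [abs_mul]
    calc _ ≤ 1 * (12 * r0) := by gcongr
      _ = _ := one_mul _
  have := neg_le_of_abs_le hprod
  have hfinal : ‖w‖ * (ε * r2) ≤ 24 * r0 := by nlinarith
  have : ‖w‖ ≤ 24 * r0 / (ε * r2) := by rwa [le_div_iff₀ (by positivity)]
  gcongr

lemma stepD_center {K : Set E3} (hK : IsConvexBody K) {c : E3}
    (b : OrthonormalBasis (Fin 3) ℝ E3) {r2 ε : ℝ} (hr2 : 0 < r2) (hε : 0 < ε)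
    (hc : ‖c‖ ≤ 6 * r2)
    (hsupp : ∀ u : E3, ‖u‖ = 1 → ⟪u, b 0⟫ = 0 → ∃ x ∈ K, ε * r2 ≤ ⟪u, x⟫) :
    ∃ t : ℝ, -(ε / 6) • c + t • b 0 ∈ K := by
  by_contra hcon
  push Not at hcon
  let L : Set E3 := Set.range fun t : ℝ => -(ε / 6) • c + t • b 0
  have hLconv : Convex ℝ L := by
    rintro _ ⟨s, rfl⟩ _ ⟨t, rfl⟩ p q hp hq hpq
    refine ⟨p * s + q * t, ?_⟩
    have : q = 1 - p := by linarith
    subst this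
    module
  have hLcl : IsClosed L := by
    have : L = {y | ⟪y + (ε / 6) • c, b 1⟫ = 0} ∩ {y | ⟪y + (ε / 6) • c, b 2⟫ = 0} := by
      ext y
      constructor
      · rintro ⟨t, rfl⟩
        constructor
        · show ⟪-(ε / 6) • c + t • b 0 + (ε / 6) • c, b 1⟫ = 0
          rw [show -(ε / 6) • c + t • b 0 + (ε / 6) • c = t • b 0 by module]
          simp [real_inner_smul_left]
        · show ⟪-(ε / 6) • c + t • b 0 + (ε / 6) • c, b 2⟫ = 0
          rw [show -(ε / 6) • c + t • b 0 + (ε / 6) • c = t • b 0 by module]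
          simp [real_inner_smul_left]
      · rintro ⟨h1, h2⟩
        have h1' : ⟪y + (ε / 6) • c, b 1⟫ = 0 := h1
        have h2' : ⟪y + (ε / 6) • c, b 2⟫ = 0 := h2
        refine ⟨⟪y + (ε / 6) • c, b 0⟫, ?_⟩
        have := b.sum_repr' (y + (ε / 6) • c)
        rw [Fin.sum_univ_three, real_inner_comm, real_inner_comm _ (b 1),
          real_inner_comm _ (b 2), h1', h2', zero_smul, zero_smul, add_zero, add_zero] at this
        simp only [this]
        module
    rw [this]
    exact (isClosed_eq (by fun_prop) (by fun_prop)).inter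
      (isClosed_eq (by fun_prop) (by fun_prop))
  have hdis : Disjoint K L := by
    rw [Set.disjoint_left]
    rintro _ hx ⟨t, rfl⟩
    exact hcon t hx
  obtain ⟨f, s, t, h1, hst, h2⟩ := geometric_hahn_banach_compact_closed hK.1 hK.2.1 hLconv hLcl hdis
  let u := (InnerProductSpace.toDual ℝ E3).symm f
  have hu : ∀ y, ⟪u, y⟫ = f y := fun y => InnerProductSpace.toDual_symm_apply
  have hlin : ∀ τ : ℝ, t < f (-(ε / 6) • c) + τ * f (b 0) := by
    intro τ
    have := h2 _ ⟨τ, rfl⟩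
    simpa using this
  have hfb : f (b 0) = 0 := by
    by_contra hne
    have := hlin ((t - f (-(ε / 6) • c)) / f (b 0))
    rw [div_mul_cancel₀ _ hne] at this
    linarith
  have hu0 : ⟪u, b 0⟫ = 0 := by rw [hu, hfb]
  have ht := hlin 0
  have hKne : K.Nonempty := hK.2.2.mono interior_subset
  have hune : u ≠ 0 := by
    intro hz
    obtain ⟨a, ha⟩ := hKne
    have h3 := h1 a ha
    rw [← hu, hz, inner_zero_left] at h3
    rw [← hu, hz, inner_zero_left] at ht
    linarith
  have hup : 0 < ‖u‖ := norm_pos_iff.2 hune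
  obtain ⟨x, hx, hxu⟩ := hsupp (‖u‖⁻¹ • u)
    (by rw [norm_smul, norm_inv, norm_norm, inv_mul_cancel₀ hup.ne'])
    (by rw [real_inner_smul_left, hu0, mul_zero])
  rw [real_inner_smul_left, inv_mul_eq_div, le_div_iff₀ hup, hu] at hxu
  have h3 := h1 x hx
  rw [← hu (-(ε / 6) • c), real_inner_smul_right] at ht
  have h4 := abs_real_inner_le_norm u c
  have h5 := neg_le_of_abs_le h4
  have h6 : ‖u‖ * ‖c‖ ≤ ‖u‖ * (6 * r2) := by gcongr
  have h7 : -(ε / 6) * ⟪u, c⟫ ≤ (ε / 6) * (‖u‖ * (6 * r2)) := by nlinarith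
  nlinarith

open scoped Pointwise in
lemma stepD {K : Set E3} (hK : IsConvexBody K) (h0 : (0:E3) ∈ K) {c : E3}
    (b : OrthonormalBasis (Fin 3) ℝ E3) {r : Fin 3 → ℝ} {ε C₂ m : ℝ} (hr : ∀ i, 0 < r i)
    (h12 : r 1 ≤ r 2) (hC : r 2 ≤ C₂ * r 1) (hC0 : 0 < C₂)
    (hε : 0 < ε) (hm : m = (ε / 6) / (1 + ε / 6))
    (hin : ∀ w : E3, ∑ i, (⟪w, b i⟫ / r i) ^ 2 ≤ 1 → c + w ∈ K)
    (hout : ∀ x ∈ K, ∀ i, |⟪x - c, b i⟫| ≤ 6 * r i) (hc : ‖c‖ ≤ 6 * r 2)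
    (hsupp : ∀ u : E3, ‖u‖ = 1 → ⟪u, b 0⟫ = 0 → ∃ x ∈ K, ε * r 2 ≤ ⟪u, x⟫)
    {N : ℕ} (hN : 3456 * C₂ / m ^ 3 ≤ N) (hN1 : 1 ≤ N) :
    m ^ 3 / (3456 * C₂ * N ^ 2) * (volume K).toReal ≤
      (volume (coneOver (gaussPre K (cap b (24 * r 0 / (ε * r 2)))))).toReal := by
  have hmp : 0 < m := by rw [hm]; positivity
  have hmle : m ≤ ε / 6 := by
    rw [hm]; exact div_le_self (by positivity) (by linarith)
  have hN0 : (0:ℝ) < N := by exact_mod_cast hN1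
  have hN1' : (1:ℝ) ≤ N := by exact_mod_cast hN1
  have hr0 := hr 0
  have hr1 := hr 1
  have hr2 := hr 2
  have hKfin : volume K ≠ ⊤ := hK.2.1.measure_lt_top.ne
  set G := coneOver (gaussPre K (cap b (24 * r 0 / (ε * r 2)))) with hG
  obtain ⟨t, ht⟩ := stepD_center hK b hr2 hε hc hsupp
  let q : E3 := ((1 + ε / 6)⁻¹ * t) • b 0
  have hq1 : ⟪q, b 1⟫ = 0 := by simp [q, real_inner_smul_left]
  have hq2 : ⟪q, b 2⟫ = 0 := by simp [q, real_inner_smul_left]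
  have hqK : ∀ w : E3, ∑ i, (⟪w, b i⟫ / r i) ^ 2 ≤ 1 → q + m • w ∈ K := by
    intro w hw
    have h1 := hin w hw
    have h2 := hK.1 ht h1 (by positivity : 0 ≤ (1 + ε / 6)⁻¹) hmp.le
      (by rw [hm]; field_simp)
    convert h2 using 1
    have h3 : m = (1 + ε / 6)⁻¹ * (ε / 6) := by rw [hm]; field_simp
    simp only [q, smul_add, smul_smul]
    rw [show m • c = ((1 + ε / 6)⁻¹ * (ε / 6)) • c by rw [← h3]]
    module
  let a : Fin 3 → ℝ := ![m * r 0 / 2, m * r 1 / (2 * N), m * r 1 / (2 * N)]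
  let B : Set E3 := {x : E3 | ∀ i, |⟪x - q, b i⟫| ≤ a i}
  have hBvol : (volume B).toReal = m ^ 3 * (r 0 * r 1 ^ 2) / N ^ 2 := by
    rw [box_volume b q a, ENNReal.toReal_ofReal]
    · simp [a]; field_simp; ring
    · simp [a]; positivity
    · intro i; fin_cases i <;> simp [a] <;> positivity
  have hBfin : volume B ≠ ⊤ := by
    rw [box_volume b q a]
    · exact ENNReal.ofReal_ne_top
    · intro i; fin_cases i <;> simp [a] <;> positivity
  have hBcoord : ∀ x ∈ B, |⟪x - q, b 0⟫| ≤ m * r 0 / 2 ∧ |⟪x - q, b 1⟫| ≤ m * r 1 / (2 * N) ∧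
      |⟪x - q, b 2⟫| ≤ m * r 1 / (2 * N) := by
    intro x hx
    exact ⟨hx 0, hx 1, hx 2⟩
  have hNle : m * r 1 / (2 * N) ≤ m * r 1 / 2 := by
    gcongr; linarith
  have hBK : B ⊆ K := by
    intro x hx
    obtain ⟨x0, x1, x2⟩ := hBcoord x hx
    have := hqK (m⁻¹ • (x - q)) ?_
    · rwa [smul_smul, mul_inv_cancel₀ hmp.ne', one_smul, add_sub_cancel] at this
    have key : ∀ (y s : ℝ), 0 < s → |y| ≤ m * s / 2 → (m⁻¹ * y / s) ^ 2 ≤ 1 / 4 := by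
      intro y s hs hy
      have h1 : |m⁻¹ * y / s| ≤ 1 / 2 := by
        rw [abs_div, abs_mul, abs_of_pos (inv_pos.2 hmp), abs_of_pos hs, div_le_iff₀ hs,
          inv_mul_le_iff₀ hmp]
        linarith
      have h2 := sq_le_sq' (by linarith [abs_nonneg (m⁻¹ * y / s)]) h1
      rw [sq_abs] at h2
      linarith
    rw [Fin.sum_univ_three]
    simp only [real_inner_smul_left]
    have k0 := key _ _ hr0 x0
    have k1 := key _ _ hr1 (x1.trans hNle)
    have k2 := key _ _ hr2 (x2.trans (hNle.trans (by gcongr)))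
    linarith
  have hBp : ∀ x ∈ B, ⟪x, b 1⟫ ^ 2 + ⟪x, b 2⟫ ^ 2 ≤ (ε * r 2 / 2 / N) ^ 2 := by
    intro x hx
    obtain ⟨x0, x1, x2⟩ := hBcoord x hx
    rw [inner_sub_left, hq1, sub_zero] at x1
    rw [inner_sub_left, hq2, sub_zero] at x2
    have y1 := sq_le_sq' (by linarith [abs_nonneg ⟪x, b 1⟫]) x1
    have y2 := sq_le_sq' (by linarith [abs_nonneg ⟪x, b 2⟫]) x2
    rw [sq_abs] at y1 y2
    have y3 : m * r 1 / (2 * N) ≤ (ε * r 2 / 2 / N) / 6 := by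
      rw [show (ε * r 2 / 2 / N) / 6 = (ε / 6) * r 2 / (2 * N) by field_simp]
      gcongr
    have y4 : (m * r 1 / (2 * N)) ^ 2 ≤ ((ε * r 2 / 2 / N) / 6) ^ 2 := by gcongr
    nlinarith [sq_nonneg (ε * r 2 / 2 / N)]
  have hcover : B ⊆ G ∪ ((N:ℝ)⁻¹ • K) := by
    intro z hz
    by_cases hz0 : z = 0
    · right
      rw [hz0]
      exact ⟨0, h0, by simp⟩
    obtain ⟨τ, hτ1, hτ⟩ := exit_point hK (hBK hz) hz0
    have hτK := hK.2.1.isClosed.frontier_subset hτ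
    have hτ0 : 0 < τ := by linarith
    by_cases hτN : τ ≤ N
    · left
      obtain ⟨ν, hν⟩ := exists_normal hK hτ
      have hcap : ν ∈ cap b (24 * r 0 / (ε * r 2)) := by
        refine stepD_cap b hr2 hε hr0 (fun x hx => hout x hx 0) hsupp hτK hν ?_
        simp only [real_inner_smul_left]
        have h1 := hBp z hz
        calc (τ * ⟪z, b 1⟫) ^ 2 + (τ * ⟪z, b 2⟫) ^ 2
            = τ ^ 2 * (⟪z, b 1⟫ ^ 2 + ⟪z, b 2⟫ ^ 2) := by ring
          _ ≤ (N:ℝ) ^ 2 * (ε * r 2 / 2 / N) ^ 2 := by gcongr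
          _ = (ε * r 2 / 2) ^ 2 := by field_simp
      refine ⟨τ • z, ⟨hτ, ν, hcap, hν⟩, τ⁻¹, ⟨by positivity, inv_le_one_of_one_le₀ hτ1⟩, ?_⟩
      rw [smul_smul, inv_mul_cancel₀ hτ0.ne', one_smul]
    · right
      push Not at hτN
      refine ⟨(N:ℝ) • z, ?_, ?_⟩
      · have := (hK.1.starConvex h0).smul_mem hτK (t := N / τ) (by positivity)
          (by rw [div_le_one hτ0]; exact hτN.le)
        rwa [smul_smul, div_mul_cancel₀ _ hτ0.ne'] at this
      · simp only [smul_smul]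
        rw [inv_mul_cancel₀ hN0.ne', one_smul]
  have hGfin : volume G ≠ ⊤ := ne_top_of_le_ne_top hKfin (measure_mono (cone_subset hK h0 _))
  have hscale : (volume ((N:ℝ)⁻¹ • K)) = ENNReal.ofReal (((N:ℝ)⁻¹) ^ 3) * volume K := by
    rw [Measure.addHaar_smul]
    rw [abs_of_pos (by simp; positivity)]
    simp
  have hvol1 : (volume B).toReal ≤ (volume G).toReal + ((N:ℝ)⁻¹) ^ 3 * (volume K).toReal := by
    have h1 : volume B ≤ volume G + ENNReal.ofReal (((N:ℝ)⁻¹) ^ 3) * volume K := by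
      rw [← hscale]
      exact (measure_mono hcover).trans (measure_union_le _ _)
    have h2 : ENNReal.ofReal (((N:ℝ)⁻¹) ^ 3) * volume K ≠ ⊤ :=
      ENNReal.mul_ne_top ENNReal.ofReal_ne_top hKfin
    have h3 := ENNReal.toReal_mono (ENNReal.add_ne_top.2 ⟨hGfin, h2⟩) h1
    rwa [ENNReal.toReal_add hGfin h2, ENNReal.toReal_mul,
      ENNReal.toReal_ofReal (by positivity)] at h3
  have hvolK : (volume K).toReal ≤ 1728 * C₂ * (r 0 * r 1 ^ 2) := by
    have h1 : K ⊆ {x : E3 | ∀ i, |⟪x - c, b i⟫| ≤ 6 * r i} := fun x hx => hout x hx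
    have h2 := measure_mono (μ := volume) h1
    rw [box_volume b c (fun i => 6 * r i) (fun i => by have := hr i; positivity)] at h2
    have h3 := ENNReal.toReal_mono ENNReal.ofReal_ne_top h2
    rw [ENNReal.toReal_ofReal (by positivity)] at h3
    refine h3.trans ?_
    have : r 0 * r 1 * r 2 ≤ r 0 * r 1 * (C₂ * r 1) := by gcongr
    nlinarith
  rw [hBvol] at hvol1
  set V := (volume K).toReal with hVdef
  have hV0 : 0 ≤ V := ENNReal.toReal_nonneg
  -- combine
  have h1 : m ^ 3 / (1728 * C₂ * N ^ 2) * V ≤ m ^ 3 * (r 0 * r 1 ^ 2) / N ^ 2 := by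
    calc m ^ 3 / (1728 * C₂ * N ^ 2) * V
        ≤ m ^ 3 / (1728 * C₂ * N ^ 2) * (1728 * C₂ * (r 0 * r 1 ^ 2)) := by gcongr
      _ = _ := by field_simp
  have h2 : ((N:ℝ)⁻¹) ^ 3 ≤ m ^ 3 / (3456 * C₂ * N ^ 2) := by
    rw [div_le_iff₀ (by positivity)] at hN
    rw [inv_pow, inv_eq_one_div, div_le_div_iff₀ (by positivity) (by positivity)]
    have : (N:ℝ) ^ 2 * (3456 * C₂) ≤ (N:ℝ) ^ 2 * (N * m ^ 3) := by gcongr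
    nlinarith
  have h3 : ((N:ℝ)⁻¹) ^ 3 * V ≤ m ^ 3 / (3456 * C₂ * N ^ 2) * V := by gcongr
  have h4 : m ^ 3 / (1728 * C₂ * N ^ 2) = 2 * (m ^ 3 / (3456 * C₂ * N ^ 2)) := by
    field_simp; norm_num
  rw [h4] at h1
  nlinarith

/-! ## The main theorem -/

lemma div_sq_mono {x s r : ℝ} (hs : 0 < s) (h : s ≤ r) : (x / r) ^ 2 ≤ (x / s) ^ 2 := by
  rw [div_pow, div_pow]
  gcongr

lemma main_aux {lam C₂ σ ε η m : ℝ} {N₁ N₂ : ℕ} (hlam : 1 < lam) (hC₂ : 0 < C₂)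
    (hσ : σ = (μH[2] unitSphere).toReal) (hσ0 : 0 < σ)
    (hfin : μH[2] unitSphere ≠ ⊤)
    (hN₁ : 52 * lam ^ 2 * C₂ * σ < N₁) (hε : ε = 1 / 2 * (1 / 4) ^ N₁)
    (hm : m = (ε / 6) / (1 + ε / 6)) (hN₂ : 3456 * C₂ / m ^ 3 ≤ N₂) (hN₂1 : 1 ≤ N₂)
    (hcap : ∀ b : OrthonormalBasis (Fin 3) ℝ E3, ∀ η' : ℝ, 0 ≤ η' → η' ≤ η →
      μH[2] (cap b η') ≤ ENNReal.ofReal (m ^ 3 / (3456 * C₂ * N₂ ^ 2) * σ / (2 * lam ^ 2)))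
    {f : E3 → ℝ} {K : Set E3} {c : E3} (b : OrthonormalBasis (Fin 3) ℝ E3) {r : Fin 3 → ℝ}
    (hf : ∀ u ∈ unitSphere, 1 / lam < f u ∧ f u < lam)
    (hK : IsConvexBody K) (h0 : (0:E3) ∈ K) (hs : SolvesLMP K f) (hr : ∀ i, 0 < r i)
    (h01 : r 0 ≤ r 1) (h12 : r 1 ≤ r 2) (hC : r 2 ≤ C₂ * r 1)
    (hin : ∀ w : E3, ∑ i, (⟪w, b i⟫ / r i) ^ 2 ≤ 1 → c + w ∈ K)
    (hout : ∀ x ∈ K, ∀ i, |⟪x - c, b i⟫| ≤ 6 * r i)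
    (hnorm : ∀ x ∈ K, ‖x - c‖ ≤ 6 * r 2)
    (hr0ε : r 0 ≤ ε * r 1) (hη : 24 * r 0 / (ε * r 1) ≤ η) : False := by
  have hr0 := hr 0
  have hr1 := hr 1
  have hr2 := hr 2
  have hε0 : 0 < ε := by rw [hε]; positivity
  have hmp : 0 < m := by rw [hm]; positivity
  obtain ⟨-, hV⟩ := lmp_bounds hlam hf hK h0 hs
  have hcn : ‖c‖ ≤ 6 * r 2 := by simpa using hnorm 0 h0
  have hε12 : r 0 ≤ ε * r 2 := hr0ε.trans (by gcongr)
  have hball : Metric.closedBall c (r 0) ⊆ K := by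
    intro x hx
    rw [mem_closedBall_iff_norm] at hx
    have := hin (x - c) ?_
    · rwa [add_sub_cancel] at this
    rw [Fin.sum_univ_three]
    have e0 := div_sq_mono (x := ⟪x - c, b 0⟫) hr0 le_rfl
    have e1 := div_sq_mono (x := ⟪x - c, b 1⟫) hr0 h01
    have e2 := div_sq_mono (x := ⟪x - c, b 2⟫) hr0 (h01.trans h12)
    have e3 : (‖x - c‖ / r 0) ^ 2 ≤ 1 := by
      rw [div_pow, div_le_one (by positivity)]; gcongr
    rw [div_pow, norm_coord b, add_div, add_div, ← div_pow, ← div_pow, ← div_pow] at e3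
    linarith
  have hw : ∀ w : E3, ⟪w, b 0⟫ = 0 → ‖w‖ ≤ r 1 → c + w ∈ K := by
    intro w hw0 hw1
    apply hin
    rw [Fin.sum_univ_three, hw0]
    have e1 := div_sq_mono (x := ⟪w, b 1⟫) hr1 le_rfl
    have e2 := div_sq_mono (x := ⟪w, b 2⟫) hr1 h12
    have e3 : (‖w‖ / r 1) ^ 2 ≤ 1 := by
      rw [div_pow, div_le_one (by positivity)]; gcongr
    rw [div_pow, norm_coord b, add_div, add_div, ← div_pow, ← div_pow, ← div_pow, hw0] at e3
    simp only [zero_div] at e3 ⊢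
    linarith
  have hx12 : ∀ x ∈ K, ‖x‖ ≤ 12 * r 2 := by
    intro x hx
    have h1 := hnorm x hx
    have h2 : ‖x‖ ≤ ‖x - c‖ + ‖c‖ := by
      calc ‖x‖ = ‖(x - c) + c‖ := by rw [sub_add_cancel]
        _ ≤ _ := norm_add_le _ _
    linarith
  have hx0 : ∀ x ∈ K, |⟪x, b 0⟫| ≤ 12 * r 0 := by
    intro x hx
    have h1 := hout x hx 0
    have h2 := hout 0 h0 0
    rw [show x = (x - c) - (0 - c) by abel, inner_sub_left]
    rw [abs_le] at *
    constructor <;> linarith [h1.1, h1.2, h2.1, h2.2]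
  have hsupp : ∀ u : E3, ‖u‖ = 1 → ⟪u, b 0⟫ = 0 → ∃ x ∈ K, ε * r 2 ≤ ⟪u, x⟫ := by
    intro u hu1 hu0
    by_contra hcon
    push Not at hcon
    have hb0 : ‖b 0‖ = 1 := b.orthonormal.1 0
    have hu0' : ⟪b 0, u⟫ = 0 := by rw [real_inner_comm]; exact hu0
    have hon : Orthonormal ℝ (({0, 2} : Set (Fin 3)).domRestrict (![b 0, 0, u] : Fin 3 → E3)) := by
      constructor
      · rintro ⟨i, hi⟩
        rcases hi with rfl | rfl
        · simpa using hb0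
        · simpa using hu1
      · rintro ⟨i, hi⟩ ⟨j, hj⟩ hij
        rcases hi with rfl | rfl <;> rcases hj with rfl | rfl
        · exact absurd rfl hij
        · simpa using hu0'
        · simpa using hu0
        · exact absurd rfl hij
    obtain ⟨b', hb'⟩ := hon.exists_orthonormalBasis_extension_of_card_eq (by simp)
    have hb'0 : b' 0 = b 0 := by simpa using hb' 0 (by simp)
    have hb'2 : b' 2 = u := by simpa using hb' 2 (by simp)
    refine stepC hK h0 b' hlam hC₂ hr1 hr2 hr0 hball hV hfin (hσ ▸ hN₁) (r0 := r 0) ?_ ?_ hx12 ?_ ?_ hC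
    · rw [hb'0]; exact hw
    · rw [hb'0]; exact hx0
    · intro x hx
      rw [hb'2, real_inner_comm, ← hε]; exact (hcon x hx).le
    · rw [← hε]; exact hε12
  have hD := stepD hK h0 b hr h12 hC hC₂ hε0 hm hin hout hcn hsupp hN₂ hN₂1
  have hη2 : 24 * r 0 / (ε * r 2) ≤ η := by
    refine le_trans ?_ hη
    gcongr
  have hcp := hcap b (24 * r 0 / (ε * r 2)) (by positivity) hη2
  have hc1 : 0 < m ^ 3 / (3456 * C₂ * N₂ ^ 2) := by
    have : (0:ℝ) < N₂ := by exact_mod_cast hN₂1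
    positivity
  set c₁ := m ^ 3 / (3456 * C₂ * N₂ ^ 2) with hc₁
  have hcp' := ENNReal.toReal_mono ENNReal.ofReal_ne_top hcp
  rw [ENNReal.toReal_ofReal (by positivity)] at hcp'
  have hVc := (hV (cap b (24 * r 0 / (ε * r 2))) (fun u hu => hu.1)
    (cap_compact _ _).measurableSet).2
  have hVS := (hV unitSphere subset_rfl unitSphere_compact.measurableSet).1
  have hVK : (volume (coneOver (gaussPre K unitSphere))).toReal ≤ (volume K).toReal :=
    ENNReal.toReal_mono hK.2.1.measure_lt_top.ne (measure_mono (cone_subset hK h0 _))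
  rw [← hσ] at hVS
  have k1 : c₁ * (σ / lam) ≤ c₁ * (3 * (volume K).toReal) := by gcongr; linarith
  have k2 : c₁ * (σ / lam) ≤ lam * (c₁ * σ / (2 * lam ^ 2)) := by
    calc c₁ * (σ / lam) ≤ 3 * (c₁ * (volume K).toReal) := by linarith
      _ ≤ 3 * (volume (coneOver (gaussPre K (cap b (24 * r 0 / (ε * r 2)))))).toReal := by linarith
      _ ≤ _ := hVc
      _ ≤ _ := by gcongr
  have k3 : lam * (c₁ * σ / (2 * lam ^ 2)) = c₁ * (σ / lam) / 2 := by field_simp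
  have k4 : 0 < c₁ * (σ / lam) := by positivity
  linarith

theorem stmt5 (lam C₂ : ℝ) (hlam : 1 < lam) (hC₂ : 0 < C₂) :
    ∃ M₀ > 0, ∀ (f : E3 → ℝ) (K E : Set E3) (c : E3) (e : Fin 3 → E3) (r : Fin 3 → ℝ),
      (∀ u ∈ unitSphere, 1 / lam < f u ∧ f u < lam) →
      IsConvexBody K → 0 ∈ K → SolvesLMP K f →
      IsEllipsoid E c e r → c = centerOfMass K → IsJohnEllipsoid K E c →
      r 0 ≤ r 1 → r 1 ≤ r 2 →
      1 / C₂ < r 2 / r 1 → r 2 / r 1 < C₂ →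
      r 1 / r 0 ≤ M₀ := by
  by_cases hfin : μH[2] unitSphere ≠ ⊤
  swap
  · refine ⟨1, one_pos, ?_⟩
    intro f K E c e r hf hK h0 hs
    exact absurd (lmp_bounds hlam hf hK h0 hs).1 hfin
  obtain ⟨σ, hσ⟩ : ∃ σ, σ = (μH[2] unitSphere).toReal := ⟨_, rfl⟩
  have hσ0 : 0 < σ := by
    have h1 := strip_measure (EuclideanSpace.basisFun (Fin 3) ℝ) (α := 0) (β := 1 / 2) le_rfl le_rfl
    have h2 := h1.trans (measure_mono (fun u hu => hu.1) : _ ≤ μH[2] unitSphere)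
    have h3 := ENNReal.toReal_mono hfin h2
    rw [ENNReal.toReal_ofReal (by norm_num)] at h3
    rw [hσ]; linarith
  obtain ⟨N₁, hN₁⟩ := exists_nat_gt (52 * lam ^ 2 * C₂ * σ)
  obtain ⟨ε, hε⟩ : ∃ ε : ℝ, ε = 1 / 2 * (1 / 4) ^ N₁ := ⟨_, rfl⟩
  have hε0 : 0 < ε := by rw [hε]; positivity
  obtain ⟨m, hm⟩ : ∃ m : ℝ, m = (ε / 6) / (1 + ε / 6) := ⟨_, rfl⟩
  have hmp : 0 < m := by rw [hm]; positivity
  obtain ⟨N₂, hN₂⟩ := exists_nat_gt (3456 * C₂ / m ^ 3)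
  have hN₂0 : (0:ℝ) < N₂ := lt_trans (by positivity) hN₂
  have hN₂1 : 1 ≤ N₂ := by exact_mod_cast hN₂0
  obtain ⟨η, hη0, hη⟩ := cap_small hfin
    (ε := ENNReal.ofReal (m ^ 3 / (3456 * C₂ * N₂ ^ 2) * σ / (2 * lam ^ 2)))
    (by rw [ENNReal.ofReal_pos]; positivity)
  refine ⟨max (1 / ε) (24 / (ε * η)), by positivity, ?_⟩
  intro f K E c e r hf hK h0 hs hE hc hJ h01 h12 _ hC
  obtain ⟨hr, hon, hEq⟩ := hE
  obtain ⟨hEK, hKE⟩ := hJ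
  have hr0 := hr 0
  have hr1 := hr 1
  have hr2 := hr 2
  obtain ⟨b, hb⟩ := (hon.comp _ Subtype.val_injective :
    Orthonormal ℝ ((Set.univ : Set (Fin 3)).domRestrict e)).exists_orthonormalBasis_extension_of_card_eq
      (by simp)
  have hbe : ∀ i, e i = b i := fun i => (hb i (Set.mem_univ i)).symm
  have hmemE : ∀ x, x ∈ E ↔ ∑ i, (⟪x - c, b i⟫ / r i) ^ 2 ≤ 1 := by
    intro x
    rw [hEq]
    simp only [hbe]
    exact Iff.rfl
  have hs6 : (3:ℝ) ^ ((3:ℝ) / 2) ≤ 6 := by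
    have h1 : ((3:ℝ) ^ ((3:ℝ) / 2)) ^ 2 = 27 := by
      rw [← Real.rpow_natCast, ← Real.rpow_mul (by norm_num)]
      norm_num
    have h2 : (0:ℝ) ≤ (3:ℝ) ^ ((3:ℝ) / 2) := by positivity
    nlinarith
  have hs0 : (0:ℝ) ≤ (3:ℝ) ^ ((3:ℝ) / 2) := by positivity
  have hdil : ∀ x ∈ K, ∃ y ∈ E, ∃ s : ℝ, 0 ≤ s ∧ s ≤ 6 ∧ x - c = s • (y - c) := by
    intro x hx
    obtain ⟨y, hy, rfl⟩ := hKE hx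
    exact ⟨y, hy, _, hs0, hs6, by simp⟩
  have hcoord : ∀ y ∈ E, ∀ i, |⟪y - c, b i⟫| ≤ r i := by
    intro y hy i
    have h1 := (hmemE y).1 hy
    have h2 : (⟪y - c, b i⟫ / r i) ^ 2 ≤ 1 :=
      (Finset.single_le_sum (f := fun i => (⟪y - c, b i⟫ / r i) ^ 2)
        (fun j _ => sq_nonneg _) (Finset.mem_univ i)).trans h1
    rw [sq_le_one_iff_abs_le_one, abs_div, abs_of_pos (hr i), div_le_one (hr i)] at h2
    exact h2
  by_contra hcon
  push Not at hcon
  have hc1 := (le_max_left _ _).trans_lt hcon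
  have hc2 := (le_max_right _ _).trans_lt hcon
  refine main_aux (f := f) (K := K) (c := c) (r := r) hlam hC₂ hσ hσ0 hfin hN₁ hε hm hN₂.le
    hN₂1 hη b hf hK h0 hs hr h01 h12 ?_ ?_ ?_ ?_ ?_ ?_
  · rw [div_lt_iff₀ hr1] at hC; exact hC.le
  · intro w hw
    apply hEK
    rw [hmemE]
    simpa using hw
  · intro x hx i
    obtain ⟨y, hy, s, hs0, hs6, hxy⟩ := hdil x hx
    rw [hxy, real_inner_smul_left, abs_mul, abs_of_nonneg hs0]
    have := hcoord y hy i
    gcongr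
  · intro x hx
    obtain ⟨y, hy, s, hs0, hs6, hxy⟩ := hdil x hx
    have hy2 : ‖y - c‖ ≤ r 2 := by
      have h1 := (hmemE y).1 hy
      rw [Fin.sum_univ_three] at h1
      have e0 := div_sq_mono (x := ⟪y - c, b 0⟫) hr0 (h01.trans h12)
      have e1 := div_sq_mono (x := ⟪y - c, b 1⟫) hr1 h12
      have e3 : (‖y - c‖ / r 2) ^ 2 ≤ 1 := by
        rw [div_pow, norm_coord b, add_div, add_div, ← div_pow, ← div_pow, ← div_pow]
        linarith
      rw [sq_le_one_iff_abs_le_one, abs_div, abs_of_pos hr2, div_le_one hr2, abs_norm] at e3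
      exact e3
    rw [hxy, norm_smul, Real.norm_of_nonneg hs0]
    gcongr
  · rw [div_lt_div_iff₀ hε0 hr0] at hc1
    linarith
  · rw [div_lt_div_iff₀ (by positivity) hr0] at hc2
    rw [div_le_iff₀ (by positivity)]
    linarith
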